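/- arXiv:2109.00826 — 2 statements merged into one kernel-verified Lean document; each statement's English description precedes it below -/
import Mathlib

section
/- Let γ > 0, c > 0, p > 2, q > 2, and let f : [0,∞) → [0,∞) be a continuous strictly increasing bijection with f(0) = 0 and inverse ψ, such that for all s > 0: (1/2)·s·f(s) − ∫₀^{s} f(t) dt ≥ γ·min{s^p, s^q} ≥ c·s·f(s). Then there exists a constant c′ > 0 depending only on c, p, q such that for all z > 0: ∫₀^{z} ψ(t) dt − (1/2)·ψ(z)·z ≥ c′·z·max{(z/γ)^{1/(p−1)}, (z/γ)^{1/(q−1)}}. -/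
open Set Filter MeasureTheory

lemma young_aux (f ψ : ℝ → ℝ) (hf : MonotoneOn f (Set.Ici 0)) (hf0 : f 0 = 0)
    (hfn : ∀ s, 0 ≤ s → 0 ≤ f s)
    (hψ : MonotoneOn ψ (Set.Ici 0)) (hinv : ∀ s, 0 ≤ s → ψ (f s) = s) (s : ℝ) (hs : 0 ≤ s) :
    s * f s ≤ (∫ t in (0:ℝ)..(f s), ψ t) + ∫ t in (0:ℝ)..s, f t := by
  have hint : ∀ g : ℝ → ℝ, MonotoneOn g (Set.Ici 0) → ∀ a b, 0 ≤ a → a ≤ b →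
      IntervalIntegrable g volume a b := by
    intro g hg a b ha hab
    apply MonotoneOn.intervalIntegrable
    rw [Set.uIcc_of_le hab]
    exact hg.mono (fun x hx => le_trans ha hx.1)
  have hlow : ∀ g : ℝ → ℝ, MonotoneOn g (Set.Ici 0) → ∀ a b, 0 ≤ a → a ≤ b →
      (∫ t in (0:ℝ)..a, g t) + (b - a) * g a ≤ ∫ t in (0:ℝ)..b, g t := by
    intro g hg a b ha hab
    rw [← intervalIntegral.integral_add_adjacent_intervals (hint g hg 0 a le_rfl ha)
      (hint g hg a b ha hab)]
    have : ∫ t in a..b, g a ≤ ∫ t in a..b, g t := by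
      apply intervalIntegral.integral_mono_on hab (by simp) (hint g hg a b ha hab)
      intro x hx
      exact hg ha (le_trans ha hx.1) hx.1
    simp only [intervalIntegral.integral_const, smul_eq_mul] at this
    linarith
  have key : ∀ h : ℝ, 0 ≤ h → ∀ k : ℕ, (k * h) * f (k * h) - h * f (k * h) ≤
      (∫ t in (0:ℝ)..(f (k * h)), ψ t) + ∫ t in (0:ℝ)..(k * h), f t := by
    intro h hh k
    induction k with
    | zero => simp [hf0]
    | succ k ih =>
      have h0 : 0 ≤ (k:ℝ) * h := by positivity
      have e : ((k+1 : ℕ):ℝ) * h = k * h + h := by push_cast; ring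
      rw [e]
      set a := (k:ℝ) * h
      have hab : a ≤ a + h := by linarith
      have hfab := hf h0 (le_trans h0 hab) hab
      have h1 := hlow f hf a (a+h) h0 hab
      have h2 := hlow ψ hψ (f a) (f (a+h)) (hfn a h0) hfab
      rw [hinv a h0] at h2
      nlinarith
  by_contra hcon
  push Not at hcon
  set I := (∫ t in (0:ℝ)..(f s), ψ t) + ∫ t in (0:ℝ)..s, f t
  obtain ⟨n, hn⟩ := exists_nat_gt (s * f s / (s * f s - I))
  have hd : 0 < s * f s - I := by linarith
  have hn0 : (0:ℝ) < n := lt_of_le_of_lt (div_nonneg (mul_nonneg hs (hfn s hs)) hd.le) hn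
  have hk := key (s / n) (by positivity) n
  rw [mul_div_cancel₀ _ hn0.ne'] at hk
  rw [div_lt_iff₀ hd] at hn
  have : s / n * f s < s * f s - I := by
    rw [div_mul_eq_mul_div, div_lt_iff₀ hn0]; linarith
  change _ ≤ I at hk
  linarith

lemma rpow_aux (c γ z s p : ℝ) (hc : 0 < c) (hγ : 0 < γ) (hz : 0 < z) (hs : 0 < s) (hp : 2 < p)
    (h : c * (s * z) ≤ γ * s ^ p) : c ^ (1 / (p - 1)) * (z / γ) ^ (1 / (p - 1)) ≤ s := by
  have hp1 : 0 < p - 1 := by linarith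
  have e : s ^ p = s * s ^ (p - 1) := by
    rw [mul_comm, ← Real.rpow_add_one hs.ne']; congr 1; ring
  have h1 : c * (z / γ) ≤ s ^ (p - 1) := by
    rw [← mul_div_assoc, div_le_iff₀ hγ]
    rw [e] at h
    have : s * (c * z) ≤ s * (s ^ (p-1) * γ) := by linarith
    exact le_of_mul_le_mul_left this hs
  rw [← Real.mul_rpow hc.le (by positivity)]
  calc _ ≤ (s ^ (p-1)) ^ (1 / (p-1)) := Real.rpow_le_rpow (by positivity) h1 (by positivity)
    _ = s := by rw [← Real.rpow_mul hs.le, mul_one_div_cancel hp1.ne', Real.rpow_one]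

/-- If `f : [0,∞) → [0,∞)` is a continuous strictly increasing bijection with `f 0 = 0`,
inverse `ψ`, satisfying `(1/2)·s·f(s) − ∫₀^{s} f ≥ γ·min{s^p, s^q} ≥ c·s·f(s)` for all
`s > 0`, then there is a constant `c′ > 0` depending only on `c, p, q` such that
`∫₀^{z} ψ − (1/2)·ψ(z)·z ≥ c′·z·max{(z/γ)^{1/(p−1)}, (z/γ)^{1/(q−1)}}` for all `z > 0`. -/
theorem dual_coercivity_bound
    (c p q : ℝ) (hc : 0 < c) (hp : 2 < p) (hq : 2 < q) :
    ∃ c' : ℝ, 0 < c' ∧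
      ∀ γ : ℝ, 0 < γ →
      ∀ f ψ : ℝ → ℝ,
        ContinuousOn f (Set.Ici 0) →
        StrictMonoOn f (Set.Ici 0) →
        (∀ s, 0 ≤ s → 0 ≤ f s) →
        f 0 = 0 →
        (∀ z, 0 ≤ z → ∃ s, 0 ≤ s ∧ f s = z) →
        (∀ z, 0 ≤ z → 0 ≤ ψ z) →
        (∀ s, 0 ≤ s → ψ (f s) = s) →
        (∀ z, 0 ≤ z → f (ψ z) = z) →
        (∀ s, 0 < s →
          γ * min (s ^ p) (s ^ q) ≤ (1/2) * s * f s - ∫ t in (0:ℝ)..s, f t ∧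
          c * (s * f s) ≤ γ * min (s ^ p) (s ^ q)) →
        ∀ z, 0 < z →
          c' * z * max ((z / γ) ^ (1 / (p - 1))) ((z / γ) ^ (1 / (q - 1)))
            ≤ (∫ t in (0:ℝ)..z, ψ t) - (1/2) * ψ z * z := by
  refine ⟨c * min (c ^ (1 / (p - 1))) (c ^ (1 / (q - 1))), by positivity, ?_⟩
  intro γ hγ f ψ _ hmono hfn hf0 _ hψn hψf hfψ H z hz
  have hψ0 := hψn z hz.le
  have hs : 0 < ψ z := by
    rcases hψ0.lt_or_eq with h | h
    · exact h
    · have := hfψ z hz.le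
      rw [← h, hf0] at this
      linarith
  have hψm : MonotoneOn ψ (Set.Ici 0) := by
    intro a ha b hb hab
    rw [← hfψ a ha, ← hfψ b hb] at hab
    exact (hmono.le_iff_le (hψn a ha) (hψn b hb)).1 hab
  have hY := young_aux f ψ hmono.monotoneOn hf0 hfn hψm hψf (ψ z) hψ0
  obtain ⟨H1, H2⟩ := H (ψ z) hs
  rw [hfψ z hz.le] at hY H1 H2
  have hP := rpow_aux c γ z (ψ z) p hc hγ hz hs hp
    (H2.trans (mul_le_mul_of_nonneg_left (min_le_left _ _) hγ.le))
  have hQ := rpow_aux c γ z (ψ z) q hc hγ hz hs hq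
    (H2.trans (mul_le_mul_of_nonneg_left (min_le_right _ _) hγ.le))
  have hM : min (c ^ (1 / (p - 1))) (c ^ (1 / (q - 1))) *
      max ((z / γ) ^ (1 / (p - 1))) ((z / γ) ^ (1 / (q - 1))) ≤ ψ z := by
    rcases max_choice ((z / γ) ^ (1 / (p - 1))) ((z / γ) ^ (1 / (q - 1))) with h | h <;> rw [h]
    · exact (mul_le_mul_of_nonneg_right (min_le_left _ _) (by positivity)).trans hP
    · exact (mul_le_mul_of_nonneg_right (min_le_right _ _) (by positivity)).trans hQ
  have := mul_le_mul_of_nonneg_left hM (mul_pos hc hz).le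
  linarith
end

section
/- Let 0 < α < 3, let q > max{2, 6−2α} with conjugate exponent q′ = q/(q−1), let C > 0, and let Γ : ℝ³ → (0,∞) be measurable with Γ(x) ≤ C(1+|x|)^{−α} for almost every x. Let K(z) = (4π|z|)^{−1} and let 𝟙_{|·|≥1} be the indicator of {z : |z| ≥ 1}. Then there exists a constant C′ > 0 depending only on C, α, q such that for every measurable P : ℝ³ → ℝ³ with ‖Γ^{−1/q}P‖_{L^{q′}} < ∞: ‖Γ^{1/q}·((K𝟙_{|·|≥1}) ∗ P)‖_{L^q} ≤ C′·‖Γ^{−1/q}P‖_{L^{q′}}, where the convolution acts componentwise. -/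
open Set MeasureTheory ENNReal

abbrev E3 := EuclideanSpace ℝ (Fin 3)

lemma young_aux_s12 (c : ℝ) (hc : 0 < c) (hc2 : c < 1 / 2) (k F : E3 → ℝ≥0∞)
    (hk : Measurable k) (hF : Measurable F) :
    (∫⁻ x, (∫⁻ y, k (x - y) * F y) ^ (1 / c)) ^ c ≤
      (∫⁻ x, k x ^ (1 / (2 * c))) ^ (2 * c) * (∫⁻ x, F x ^ (1 / (1 - c))) ^ (1 - c) := by
  set A := ∫⁻ x, k x ^ (1 / (2 * c)) with hA
  set B := ∫⁻ x, F x ^ (1 / (1 - c)) with hB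
  have h1c : 0 < 1 - c := by linarith
  have h12c : 0 < 1 - 2 * c := by linarith
  have hmeas : Measurable (fun p : E3 × E3 => k (p.1 - p.2) ^ (1 / (2 * c)) * F p.2 ^ (1 / (1 - c))) := by
    fun_prop
  have hpt : ∀ x, (∫⁻ y, k (x - y) * F y) ≤
      (∫⁻ y, k (x - y) ^ (1 / (2 * c)) * F y ^ (1 / (1 - c))) ^ c * A ^ c * B ^ (1 - 2 * c) := by
    intro x
    have := ENNReal.lintegral_prod_norm_pow_le (μ := (volume : Measure E3)) (Finset.univ : Finset (Fin 3))
      (f := ![fun y => k (x - y) ^ (1 / (2 * c)) * F y ^ (1 / (1 - c)),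
        fun y => k (x - y) ^ (1 / (2 * c)), fun y => F y ^ (1 / (1 - c))])
      (p := ![c, c, 1 - 2 * c]) ?_ ?_ ?_
    · simp only [Fin.prod_univ_three, Matrix.cons_val_zero, Matrix.cons_val_one, Matrix.cons_val] at this
      rw [lintegral_sub_left_eq_self (fun y => k y ^ (1 / (2 * c))) x] at this
      refine le_trans (le_of_eq ?_) this
      refine lintegral_congr fun y => ?_
      rw [ENNReal.mul_rpow_of_nonneg _ _ hc.le, ← ENNReal.rpow_mul, ← ENNReal.rpow_mul,
        ← ENNReal.rpow_mul]
      have e1 : 1 / (2 * c) * c = 1 / 2 := by field_simp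
      rw [e1]
      have e2 : k (x - y) ^ (1 / 2 : ℝ) * k (x - y) ^ (1 / 2 : ℝ) = k (x - y) := by
        rw [← ENNReal.rpow_add_of_nonneg _ _ (by norm_num) (by norm_num)]; norm_num
      have e3 : F y ^ (1 / (1 - c) * c) * F y ^ (1 / (1 - c) * (1 - 2 * c)) = F y := by
        rw [← ENNReal.rpow_add_of_nonneg _ _ (by positivity) (by positivity)]
        have : 1 / (1 - c) * c + 1 / (1 - c) * (1 - 2 * c) = 1 := by
          field_simp; ring
        rw [this, ENNReal.rpow_one]
      calc k (x - y) * F y = (k (x - y) ^ (1 / 2 : ℝ) * k (x - y) ^ (1 / 2 : ℝ)) *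
          (F y ^ (1 / (1 - c) * c) * F y ^ (1 / (1 - c) * (1 - 2 * c))) := by rw [e2, e3]
        _ = _ := by ring
    · intro i _
      fin_cases i <;> simp <;> fun_prop
    · simp [Fin.sum_univ_three]; ring
    · intro i _
      fin_cases i <;> simp <;> linarith
  have hint : (∫⁻ x, (∫⁻ y, k (x - y) * F y) ^ (1 / c)) ≤ A * B * (A * B ^ ((1 - 2 * c) / c)) := by
    calc _ ≤ ∫⁻ x, (∫⁻ y, k (x - y) ^ (1 / (2 * c)) * F y ^ (1 / (1 - c))) * (A * B ^ ((1 - 2 * c) / c)) := by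
          refine lintegral_mono fun x => ?_
          refine (ENNReal.rpow_le_rpow (hpt x) (by positivity : 0 ≤ 1 / c)).trans (le_of_eq ?_)
          rw [ENNReal.mul_rpow_of_nonneg _ _ (by positivity), ENNReal.mul_rpow_of_nonneg _ _ (by positivity),
            ← ENNReal.rpow_mul, ← ENNReal.rpow_mul, ← ENNReal.rpow_mul,
            mul_one_div_cancel hc.ne', ENNReal.rpow_one, ENNReal.rpow_one, mul_one_div, mul_assoc]
      _ = _ := by
          rw [lintegral_mul_const _ (by fun_prop)]
          congr 1
          rw [lintegral_lintegral_swap (by exact hmeas.aemeasurable)]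
          have : ∀ y, (∫⁻ x, k (x - y) ^ (1 / (2 * c)) * F y ^ (1 / (1 - c))) = A * F y ^ (1 / (1 - c)) := by
            intro y
            rw [lintegral_mul_const _ (by fun_prop), lintegral_sub_right_eq_self (fun z => k z ^ (1 / (2 * c))) y]
          simp_rw [this]
          rw [lintegral_const_mul _ (by fun_prop)]
  refine (ENNReal.rpow_le_rpow hint hc.le).trans (le_of_eq ?_)
  rw [ENNReal.mul_rpow_of_nonneg _ _ hc.le, ENNReal.mul_rpow_of_nonneg _ _ hc.le,
    ENNReal.mul_rpow_of_nonneg _ _ hc.le, ← ENNReal.rpow_mul, div_mul_cancel₀ _ hc.ne',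
    two_mul, ENNReal.rpow_add_of_nonneg _ _ hc.le hc.le]
  have : B ^ (1 - c) = B ^ c * B ^ (1 - (c + c)) := by
    rw [← ENNReal.rpow_add_of_nonneg _ _ hc.le (by linarith)]; congr 1; ring
  rw [this]; ring

lemma main_aux (q c : ℝ) (hq : 2 < q) (hc : 0 < c) (hcq : c < 1 / q) (k w f : E3 → ℝ≥0∞)
    (hk : Measurable k) (hw : Measurable w) (hf : Measurable f) :
    (∫⁻ x, (w x * ∫⁻ y, k (x - y) * (w y * f y)) ^ q) ^ (1 / q) ≤
      ((∫⁻ x, w x ^ (1 / (1 / q - c))) ^ (1 / q - c) * (∫⁻ x, k x ^ (1 / (2 * c))) ^ (2 * c) *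
        (∫⁻ x, w x ^ (1 / (1 / q - c))) ^ (1 / q - c)) *
        (∫⁻ x, f x ^ (q / (q - 1))) ^ (1 / (q / (q - 1))) := by
  have hq0 : 0 < q := by linarith
  have hq2 : 1 / q < 1 / 2 := one_div_lt_one_div_of_lt (by norm_num) hq
  have ha : 0 < 1 / q - c := by linarith
  have h1 := ENNReal.lintegral_Lp_mul_le_Lq_mul_Lr (p := q) (q := 1 / (1 / q - c)) (r := 1 / c) hq0
    (by rw [lt_one_div hq0 ha]; linarith) (by rw [one_div_one_div, one_div_one_div]; ring)
    (volume : Measure E3) (f := w) (g := fun x => ∫⁻ y, k (x - y) * (w y * f y))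
    (by fun_prop) (by fun_prop)
  have h2 := young_aux_s12 c hc (by linarith) k (fun y => w y * f y) hk (by fun_prop)
  have h1c : 0 < 1 - c := by linarith
  have hqq : 1 / (q / (q - 1)) = 1 - 1 / q := by field_simp
  have h3 := ENNReal.lintegral_Lp_mul_le_Lq_mul_Lr (p := 1 / (1 - c)) (q := 1 / (1 / q - c))
    (r := q / (q - 1)) (by positivity)
    (by apply one_div_lt_one_div_of_lt ha; linarith)
    (by rw [one_div_one_div, one_div_one_div, hqq]; ring)
    (volume : Measure E3) (f := w) (g := f) (by fun_prop) (by fun_prop)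
  simp only [one_div_one_div, Pi.mul_apply] at h1 h3
  calc _ ≤ _ := h1
    _ ≤ _ := mul_le_mul_right h2 _
    _ ≤ _ := mul_le_mul_right (mul_le_mul_right h3 _) _
    _ = _ := by ring

lemma fin_aux (D β p : ℝ) (hD : 0 < D) (hp : 0 < p) (h : 3 < β * p) :
    (∫⁻ x : E3, (ENNReal.ofReal (D * (1 + ‖x‖) ^ (-β))) ^ p) < ⊤ := by
  have h0 := finite_integral_one_add_norm (E := E3) (μ := volume) (r := β * p) (by simpa using h)
  have : ∀ x : E3, (ENNReal.ofReal (D * (1 + ‖x‖) ^ (-β))) ^ p =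
      ENNReal.ofReal (D ^ p) * ENNReal.ofReal ((1 + ‖x‖) ^ (-(β * p))) := by
    intro x
    rw [ENNReal.ofReal_rpow_of_nonneg (by positivity) hp.le, Real.mul_rpow (by positivity) (by positivity),
      ← Real.rpow_mul (by positivity), ENNReal.ofReal_mul (by positivity), neg_mul]
  simp_rw [this]
  rw [lintegral_const_mul _ (by fun_prop)]
  exact ENNReal.mul_lt_top ENNReal.ofReal_lt_top h0



/-- Long-range part of the Newtonian potential: for `0 < α < 3`,
`q > max{2, 6−2α}` with conjugate exponent `q′`, and `Γ(x) ≤ C(1+|x|)^{−α}` a.e.,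
there is `C′ > 0` depending only on `C, α, q` such that for every measurable `P` with
`‖Γ^{−1/q}P‖_{q′} < ∞` one has
`‖Γ^{1/q}·((K𝟙_{|·|≥1}) ∗ P)‖_q ≤ C′·‖Γ^{−1/q}P‖_{q′}`, where `K(z) = (4π|z|)⁻¹` and the
convolution acts componentwise. -/
theorem long_range_convolution_bound
    (α q q' C : ℝ) (hα0 : 0 < α) (hα3 : α < 3)
    (hq : max 2 (6 - 2 * α) < q) (hq' : q' = q / (q - 1)) (hC : 0 < C) :
    ∃ C' : ℝ, 0 < C' ∧
      ∀ Γ : EuclideanSpace ℝ (Fin 3) → ℝ,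
        Measurable Γ → (∀ x, 0 < Γ x) →
        (∀ᵐ x ∂volume, Γ x ≤ C * (1 + ‖x‖) ^ (-α)) →
        ∀ K : EuclideanSpace ℝ (Fin 3) → ℝ,
          (∀ z, K z = (4 * Real.pi * ‖z‖)⁻¹) →
          ∀ P : EuclideanSpace ℝ (Fin 3) → EuclideanSpace ℝ (Fin 3), Measurable P →
            (∫⁻ x, ENNReal.ofReal (Γ x ^ (1 - q') * ‖P x‖ ^ q')) ^ (1 / q') < ⊤ →
            (∫⁻ x, ENNReal.ofReal
                ((Γ x ^ (1 / q) *
                  ‖∫ y, Set.indicator {z : EuclideanSpace ℝ (Fin 3) | 1 ≤ ‖z‖} K (x - y) • P y‖) ^ q))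
                ^ (1 / q)
              ≤ ENNReal.ofReal C'
                * (∫⁻ x, ENNReal.ofReal (Γ x ^ (1 - q') * ‖P x‖ ^ q')) ^ (1 / q') := by
  have hq2 : 2 < q := lt_of_le_of_lt (le_max_left _ _) hq
  have hq6 : 6 - 2 * α < q := lt_of_le_of_lt (le_max_right _ _) hq
  have hq0 : 0 < q := by linarith
  obtain ⟨c, hcL, hcR⟩ : ∃ c, (1 - α / 3) / q < c ∧ c < min (1 / q) (1 / 6) := by
    apply exists_between
    rw [lt_min_iff]
    constructor
    · apply div_lt_div_of_pos_right _ hq0; linarith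
    · rw [div_lt_div_iff₀ hq0 (by norm_num)]; linarith
  rw [lt_min_iff] at hcR
  obtain ⟨hcq, hc6⟩ := hcR
  have hc : 0 < c := lt_trans (div_pos (by linarith) hq0) hcL
  have ha : 0 < 1 / q - c := by linarith
  let w : E3 → ℝ≥0∞ := fun x => ENNReal.ofReal (C * (1 + ‖x‖) ^ (-α)) ^ (1 / q)
  let k : E3 → ℝ≥0∞ := fun x => ENNReal.ofReal (2 * (1 + ‖x‖) ^ (-(1:ℝ))) 
  have hw : Measurable w := by fun_prop
  have hk : Measurable k := by fun_prop
  set M : ℝ≥0∞ := (∫⁻ x, w x ^ (1 / (1 / q - c))) ^ (1 / q - c) * (∫⁻ x, k x ^ (1 / (2 * c))) ^ (2 * c) *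
        (∫⁻ x, w x ^ (1 / (1 / q - c))) ^ (1 / q - c) with hM
  have hW : (∫⁻ x, w x ^ (1 / (1 / q - c))) < ⊤ := by
    simp only [w, ← ENNReal.rpow_mul]
    apply fin_aux _ _ _ hC (by positivity)
    have : α * (1 / q * (1 / (1 / q - c))) = α / q / (1 / q - c) := by ring
    rw [this, lt_div_iff₀ ha]
    have : (1 - α / 3) / q = 1 / q - α / q / 3 := by ring
    linarith
  have hKf : (∫⁻ x, k x ^ (1 / (2 * c))) < ⊤ := by
    apply fin_aux _ _ _ (by norm_num) (by positivity)
    rw [one_mul, lt_div_iff₀ (by positivity)]; linarith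
  have hMt : M < ⊤ := ENNReal.mul_lt_top (ENNReal.mul_lt_top
    (ENNReal.rpow_lt_top_of_nonneg ha.le hW.ne)
    (ENNReal.rpow_lt_top_of_nonneg (by positivity) hKf.ne))
    (ENNReal.rpow_lt_top_of_nonneg ha.le hW.ne)
  refine ⟨M.toReal + 1, by positivity, ?_⟩
  intro Γ hΓm hΓ hΓC K hK P hP _
  let f : E3 → ℝ≥0∞ := fun x => ENNReal.ofReal (Γ x ^ (-(1 / q)) * ‖P x‖)
  have hf : Measurable f := by fun_prop
  have hwΓ : ∀ᵐ x, ENNReal.ofReal (Γ x ^ (1 / q)) ≤ w x := by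
    filter_upwards [hΓC] with x hx
    rw [← ENNReal.ofReal_rpow_of_nonneg (hΓ x).le (by positivity)]
    exact ENNReal.rpow_le_rpow (ENNReal.ofReal_le_ofReal hx) (by positivity)
  have hP' : ∀ᵐ x, ‖P x‖ₑ ≤ w x * f x := by
    filter_upwards [hwΓ] with x hx
    refine le_trans (le_of_eq ?_) (mul_le_mul_left hx (f x))
    simp only [f]
    rw [← ENNReal.ofReal_mul (Real.rpow_nonneg (hΓ x).le _), ← mul_assoc, ← Real.rpow_add (hΓ x),
      add_neg_cancel, Real.rpow_zero, one_mul, ofReal_norm]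
  have hkK : ∀ z, ‖Set.indicator {z : EuclideanSpace ℝ (Fin 3) | 1 ≤ ‖z‖} K z‖ₑ ≤ k z := by
    intro z
    by_cases hz : 1 ≤ ‖z‖
    · rw [Set.indicator_of_mem (by exact hz), hK, Real.enorm_eq_ofReal (by positivity)]
      apply ENNReal.ofReal_le_ofReal
      rw [Real.rpow_neg_one, ← div_eq_mul_inv, inv_eq_one_div, div_le_div_iff₀ (by positivity) (by positivity)]
      nlinarith [Real.pi_gt_three]
    · rw [Set.indicator_of_notMem (by exact hz)]; simp
  have hf' : ∀ x, f x ^ (q / (q - 1)) = ENNReal.ofReal (Γ x ^ (1 - q') * ‖P x‖ ^ q') := by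
    intro x
    have h1 : 0 < q - 1 := by linarith
    have := (hΓ x).le
    simp only [f]
    rw [ENNReal.ofReal_rpow_of_nonneg (by positivity) (by positivity), Real.mul_rpow (by positivity) (by positivity),
      ← Real.rpow_mul this, hq']
    congr 3
    field_simp; ring
  have hmain := main_aux q c hq2 hc hcq k w f hk hw hf
  simp only [hf'] at hmain
  simp only [← hq'] at hmain
  rw [← hM] at hmain
  refine le_trans ?_ (hmain.trans (mul_le_mul_left ?_ _))
  · refine ENNReal.rpow_le_rpow (lintegral_mono_ae ?_) (by positivity)
    filter_upwards [hwΓ] with x hx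
    have := (hΓ x).le
    rw [← ENNReal.ofReal_rpow_of_nonneg (by positivity) hq0.le, ENNReal.ofReal_mul (by positivity), ofReal_norm]
    refine ENNReal.rpow_le_rpow (mul_le_mul' hx ?_) hq0.le
    refine (enorm_integral_le_lintegral_enorm _).trans (lintegral_mono_ae ?_)
    filter_upwards [hP'] with y hy
    rw [enorm_smul]
    exact mul_le_mul' (hkK _) hy
  · rw [ENNReal.le_ofReal_iff_toReal_le hMt.ne (by positivity)]
    linarith
end
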